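/- Under the AOA algorithm (losses valued in [0,1], convex, G-Lipschitz gradients, domain diameter at most D), for every interval I = [r,s] of positive integers and every comparator sequence u_r,…,u_s ∈ Ω, Σ_{t=r}^{s} f_t(w_t) − Σ_{t=r}^{s} f_t(u_t) ≤ ( 14·√(c'(s)) + 3·(1 + 2·ln(k_I+1)) + 23·DG )·√|I| + 5G·√(D·P_I)·√|I|, where |I| = s−r+1, c'(s) = 1 + ln s + ln(1 + log₂ s) + ln( (5 + 3 ln(1+s))/2 ), P_I = Σ_{t=r}^{s−1} ‖u_{t+1}−u_t‖₂, and k_I = ⌊ (1/2)·log₂(1 + 4P_I/(7D)) ⌋ + 1. -/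

import Mathlib

/-- The AdaNormalHedge potential `Φ(R,C) = exp([R]₊²/(3C))` (with `Φ(R,0) = 1`,
matching `Φ(0,0) = 1`, since `x/0 = 0` in Lean). -/
noncomputable def anhPot (R C : ℝ) : ℝ := Real.exp (max R 0 ^ 2 / (3 * C))

/-- The AdaNormalHedge weight function `w(R,C) = (Φ(R+1,C+1) − Φ(R−1,C+1))/2`. -/
noncomputable def anhW (R C : ℝ) : ℝ := (anhPot (R + 1) (C + 1) - anhPot (R - 1) (C + 1)) / 2

/-- The number of experts of Ader with horizon `m`: `N = ⌈(1/2)log₂(1 + 4m/7)⌉ + 1`. -/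
noncomputable def aderN (m : ℕ) : ℕ := ⌈Real.logb 2 (1 + 4 * (m : ℝ) / 7) / 2⌉₊ + 1

/-- The `j`-th step size of Ader with horizon `m`: `η_j = 2^{j−1}(D/G)√(7/(2m))`. -/
noncomputable def aderEta (D G : ℝ) (m j : ℕ) : ℝ :=
  2 ^ (j - 1) * (D / G) * Real.sqrt (7 / (2 * (m : ℝ)))

/-- The Hedge learning rate of Ader with horizon `m`: `α = √(8/m)`. -/
noncomputable def aderAlpha (m : ℕ) : ℝ := Real.sqrt (8 / (m : ℝ))

/-- The levels `k` whose geometric covering interval `[i·2^k, (i+1)·2^k − 1] ∈ 𝓘_k`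
containing round `t` has index `i = ⌊t/2^k⌋ ≥ 1`; these index the experts of AOA
active at round `t` (one per level). -/
def gcLevels (t : ℕ) : Finset ℕ := (Finset.range (t + 1)).filter fun k => 2 ^ k ≤ t

/-- `R_{t−1,I} = Σ_{u=min I}^{t−1} (f_u(w_u) − f_u(w_{u,I}))` for the active level-`k`
expert at round `t`, whose interval `I ∈ 𝓘_k` has index `⌊t/2^k⌋` and starts at
`⌊t/2^k⌋·2^k`; `wI k i u` is the action at round `u` of the Ader expert associated
with the `i`-th interval of level `k`. -/
noncomputable def aoaMetaR {α : Type*} (f : ℕ → α → ℝ) (w : ℕ → α)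
    (wI : ℕ → ℕ → ℕ → α) (k t : ℕ) : ℝ :=
  ∑ u ∈ Finset.Icc (t / 2 ^ k * 2 ^ k) (t - 1), (f u (w u) - f u (wI k (t / 2 ^ k) u))

/-- `C_{t−1,I} = Σ_{u=min I}^{t−1} |f_u(w_u) − f_u(w_{u,I})|` for the active level-`k`
expert at round `t`. -/
noncomputable def aoaMetaC {α : Type*} (f : ℕ → α → ℝ) (w : ℕ → α)
    (wI : ℕ → ℕ → ℕ → α) (k t : ℕ) : ℝ :=
  ∑ u ∈ Finset.Icc (t / 2 ^ k * 2 ^ k) (t - 1), |f u (w u) - f u (wI k (t / 2 ^ k) u)|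

/-- The AdaNormalHedge weight `p_{t,I}` that AOA assigns to the active level-`k`
expert at round `t`. -/
noncomputable def aoaWeight {α : Type*} (f : ℕ → α → ℝ) (w : ℕ → α)
    (wI : ℕ → ℕ → ℕ → α) (k t : ℕ) : ℝ :=
  anhW (aoaMetaR f w wI k t) (aoaMetaC f w wI k t) /
    ∑ k' ∈ gcLevels t, anhW (aoaMetaR f w wI k' t) (aoaMetaC f w wI k' t)

/-- `c'(t) = 1 + ln t + ln(1 + log₂ t) + ln((5 + 3 ln(1+t))/2)`. -/
noncomputable def cAOA (t : ℕ) : ℝ :=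
  1 + Real.log t + Real.log (1 + Real.logb 2 t) + Real.log ((5 + 3 * Real.log (1 + (t : ℝ))) / 2)


section AdaNormalHedge

/-- Joint convexity of `(x, p) ↦ x² / p`. -/
lemma sq_div_convex {a x y p q : ℝ} (ha0 : 0 ≤ a) (ha1 : a ≤ 1) (hp : 0 < p) (hq : 0 < q) :
    ((1 - a) * x + a * y) ^ 2 / ((1 - a) * p + a * q) ≤ (1 - a) * (x ^ 2 / p) + a * (y ^ 2 / q) := by
  have hden : 0 < (1 - a) * p + a * q := by
    rcases eq_or_lt_of_le ha0 with h | h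
    · subst h; simpa using hp
    · have := mul_pos h hq
      have := mul_nonneg (sub_nonneg.2 ha1) hp.le
      linarith
  rw [div_le_iff₀ hden]
  have key : ((1 - a) * (x ^ 2 / p) + a * (y ^ 2 / q)) * ((1 - a) * p + a * q)
      - ((1 - a) * x + a * y) ^ 2 = (1 - a) * a * (x * q - y * p) ^ 2 / (p * q) := by
    field_simp
    ring
  have : 0 ≤ (1 - a) * a * (x * q - y * p) ^ 2 / (p * q) :=
    div_nonneg (mul_nonneg (mul_nonneg (sub_nonneg.2 ha1) ha0) (sq_nonneg _)) (mul_pos hp hq).le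
  linarith

lemma exp_convex_comb {a x y : ℝ} (ha0 : 0 ≤ a) (ha1 : a ≤ 1) :
    Real.exp ((1 - a) * x + a * y) ≤ (1 - a) * Real.exp x + a * Real.exp y := by
  simpa [smul_eq_mul] using convexOn_exp.2 (Set.mem_univ x) (Set.mem_univ y)
    (sub_nonneg.2 ha1) ha0 (by ring)

lemma one_le_anhPot (R : ℝ) {C : ℝ} (hC : 0 ≤ C) : 1 ≤ anhPot R C := by
  unfold anhPot
  exact Real.one_le_exp (by positivity)

lemma anhPot_mono {R R' C : ℝ} (hC : 0 ≤ C) (h : R ≤ R') : anhPot R C ≤ anhPot R' C := by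
  unfold anhPot
  gcongr

lemma anhW_nonneg (R : ℝ) {C : ℝ} (hC : 0 ≤ C) : 0 ≤ anhW R C := by
  unfold anhW
  have := anhPot_mono (R := R - 1) (R' := R + 1) (C := C + 1) (by linarith) (by linarith)
  linarith

lemma anhW_zero_pos : 0 < anhW 0 0 := by
  have h : (0 : ℝ) < 1 / 3 := by norm_num
  have := Real.add_one_lt_exp h.ne'
  unfold anhW anhPot
  norm_num at this ⊢

/-- The AdaNormalHedge potential is convex along segments towards `(R ± 1, C + 1)`. -/
lemma anhPot_segment {R C a σ : ℝ} (hC : 0 ≤ C) (hRC : C = 0 → R = 0) (ha0 : 0 ≤ a)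
    (ha1 : a ≤ 1) :
    anhPot (R + a * σ) (C + a) ≤ (1 - a) * anhPot R C + a * anhPot (R + σ) (C + 1) := by
  unfold anhPot
  refine le_trans (Real.exp_le_exp.2 ?_) (exp_convex_comb ha0 ha1)
  rcases eq_or_lt_of_le hC with h | h
  · have hR := hRC h.symm
    subst hR; subst h
    rcases eq_or_lt_of_le ha0 with h | h
    · subst h; simp
    · have : max (a * σ) 0 = a * max σ 0 := by
        rw [mul_max_of_nonneg _ _ ha0, mul_zero]
      simp only [zero_add, this]
      apply le_of_eq
      field_simp
      simp
  · have h1 : max (R + a * σ) 0 ≤ (1 - a) * max R 0 + a * max (R + σ) 0 := by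
      have e1 := mul_le_mul_of_nonneg_left (le_max_left R 0) (sub_nonneg.2 ha1)
      have e2 := mul_le_mul_of_nonneg_left (le_max_left (R + σ) 0) ha0
      have e3 := mul_nonneg (sub_nonneg.2 ha1) (le_max_right R 0)
      have e4 := mul_nonneg ha0 (le_max_right (R + σ) 0)
      apply max_le <;> nlinarith
    have h2 := sq_div_convex (x := max R 0) (y := max (R + σ) 0) ha0 ha1
      (show 0 < 3 * C by linarith) (show 0 < 3 * (C + 1) by linarith)
    refine le_trans ?_ h2
    rw [show (1 - a) * (3 * C) + a * (3 * (C + 1)) = 3 * (C + a) by ring]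
    have := le_max_right (R + a * σ) 0
    gcongr

lemma anhPot_midpoint {R C : ℝ} (hC : 0 ≤ C) (hRC : C = 0 → R = 0) :
    (anhPot (R + 1) (C + 1) + anhPot (R - 1) (C + 1)) / 2 ≤ anhPot R C + 3 / (2 * (C + 1)) := by
  have hC1 : 0 < C + 1 := by linarith
  have hv1 : 1 / (C + 1) ≤ 1 := by rw [div_le_one hC1]; linarith
  have hv0 : 0 < 1 / (C + 1) := by positivity
  have hrhs : 3 / (2 * (C + 1)) = 3 / 2 * (1 / (C + 1)) := by field_simp
  rw [hrhs]
  rcases le_or_gt R 1 with hR | hR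
  · have h0 : anhPot (R - 1) (C + 1) = 1 := by
      unfold anhPot
      rw [max_eq_right (by linarith)]; simp
    have h1 := one_le_anhPot R hC
    have h2 : anhPot (R + 1) (C + 1) ≤ 1 + 3 * (1 / (C + 1)) := by
      have e1 : anhPot (R + 1) (C + 1) ≤ anhPot 2 (C + 1) := anhPot_mono hC1.le (by linarith)
      have e2 : anhPot 2 (C + 1) =
          Real.exp ((1 - 1 / (C + 1)) * 0 + 1 / (C + 1) * (4 / 3)) := by
        unfold anhPot
        rw [max_eq_left (by norm_num)]
        congr 1; field_simp; norm_num
      have e3 := exp_convex_comb (x := 0) (y := 4 / 3) hv0.le hv1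
      have e4 : Real.exp (4 / 3) ≤ 4 := by
        have h3 : Real.exp (4 / 3) ^ 3 ≤ 4 ^ 3 := by
          rw [← Real.exp_nat_mul]
          have : ((3 : ℕ) : ℝ) * (4 / 3) = (4 : ℕ) * 1 := by norm_num
          rw [this, Real.exp_nat_mul]
          have := Real.exp_one_lt_d9.le
          calc Real.exp 1 ^ 4 ≤ (2.7182818286 : ℝ) ^ 4 := by gcongr
            _ ≤ 4 ^ 3 := by norm_num
        exact le_of_pow_le_pow_left₀ (by norm_num) (by norm_num) h3
      rw [Real.exp_zero] at e3
      nlinarith [mul_le_mul_of_nonneg_left e4 hv0.le]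
    linarith
  · have hCpos : 0 < C := lt_of_le_of_ne hC fun h => by
      have := hRC h.symm; linarith
    have hcosh : (anhPot (R + 1) (C + 1) + anhPot (R - 1) (C + 1)) / 2 =
        Real.exp ((R ^ 2 + 1) / (3 * (C + 1))) * Real.cosh (2 * R / (3 * (C + 1))) := by
      have e1 : (R + 1) ^ 2 / (3 * (C + 1)) =
          (R ^ 2 + 1) / (3 * (C + 1)) + 2 * R / (3 * (C + 1)) := by ring
      have e2 : (R - 1) ^ 2 / (3 * (C + 1)) =
          (R ^ 2 + 1) / (3 * (C + 1)) + -(2 * R / (3 * (C + 1))) := by ring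
      unfold anhPot
      rw [max_eq_left (by linarith), max_eq_left (by linarith), Real.cosh_eq, e1, e2,
        Real.exp_add, Real.exp_add]
      ring
    have hz : anhPot R C = Real.exp (R ^ 2 / (3 * C)) := by
      unfold anhPot; rw [max_eq_left (by linarith)]
    set z := R ^ 2 / (3 * C) with hzdef
    set δ := 1 / (3 * (C + 1)) with hδ
    have hδ0 : 0 ≤ δ := by positivity
    have hδ3 : 3 * δ = 1 / (C + 1) := by rw [hδ]; field_simp
    have hδ1 : δ ≤ 1 := by linarith
    have hle : (anhPot (R + 1) (C + 1) + anhPot (R - 1) (C + 1)) / 2 ≤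
        Real.exp ((1 - δ) * z + δ * 1) := by
      rw [hcosh]
      refine le_trans (mul_le_mul_of_nonneg_left (Real.cosh_le_exp_half_sq _)
        (Real.exp_pos _).le) ?_
      rw [← Real.exp_add]
      apply Real.exp_le_exp.2
      have : (1 - δ) * z + δ * 1 -
          ((R ^ 2 + 1) / (3 * (C + 1)) + (2 * R / (3 * (C + 1))) ^ 2 / 2) =
          2 * R ^ 2 / (9 * C * (C + 1) ^ 2) := by
        rw [hzdef, hδ]; field_simp; ring
      have : 0 ≤ 2 * R ^ 2 / (9 * C * (C + 1) ^ 2) := by positivity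
      linarith
    have h2 := exp_convex_comb (x := z) (y := 1) hδ0 hδ1
    have h3 : Real.exp 1 ≤ 3 := by linarith [Real.exp_one_lt_d9]
    rw [hz]
    nlinarith [mul_le_mul_of_nonneg_left h3 hδ0, mul_nonneg hδ0 (Real.exp_pos z).le]

lemma anhPot_step {R C ρ : ℝ} (hC : 0 ≤ C) (hRC : C = 0 → R = 0) (hρ : |ρ| ≤ 1) :
    anhPot (R + ρ) (C + |ρ|) ≤ anhPot R C + anhW R C * ρ + 3 / 2 * (|ρ| / (C + 1)) := by
  have hmid := mul_le_mul_of_nonneg_left (anhPot_midpoint hC hRC) (abs_nonneg ρ)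
  have e : |ρ| * (3 / (2 * (C + 1))) = 3 / 2 * (|ρ| / (C + 1)) := by
    have : C + 1 ≠ 0 := by linarith
    field_simp
  rw [mul_add, e] at hmid
  unfold anhW
  rcases le_total 0 ρ with h | h
  · rw [abs_of_nonneg h] at hmid hρ ⊢
    have := anhPot_segment (σ := 1) hC hRC h hρ
    rw [mul_one] at this
    linarith
  · rw [abs_of_nonpos h] at hmid hρ ⊢
    have := anhPot_segment (σ := -1) hC hRC (neg_nonneg.2 h) hρ
    rw [show R + -ρ * -1 = R + ρ by ring, ← sub_eq_add_neg R 1] at this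
    linarith

lemma div_add_one_le_telescope {C a : ℝ} (hC : 0 ≤ C) (ha0 : 0 ≤ a) (ha1 : a ≤ 1) :
    a / (C + 1) ≤ (1 / (C + 1) - 1 / (C + a + 1)) +
      (Real.log (C + a + 1) - Real.log (C + 1)) := by
  have h1 : 0 < C + 1 := by linarith
  have h2 : 0 < C + a + 1 := by linarith
  have h3 := Real.one_sub_inv_le_log_of_pos (div_pos h2 h1)
  rw [Real.log_div h2.ne' h1.ne'] at h3
  have h4 : a / (C + 1) - (1 / (C + 1) - 1 / (C + a + 1)) ≤ 1 - ((C + a + 1) / (C + 1))⁻¹ := by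
    have : 1 - ((C + a + 1) / (C + 1))⁻¹ - (a / (C + 1) - (1 / (C + 1) - 1 / (C + a + 1))) =
        a * (1 - a) / ((C + 1) * (C + a + 1)) := by
      field_simp; ring
    have : 0 ≤ a * (1 - a) / ((C + 1) * (C + a + 1)) :=
      div_nonneg (mul_nonneg ha0 (by linarith)) (by positivity)
    linarith
  linarith

/-- Potential growth of a single AdaNormalHedge expert. -/
lemma anhPot_le_sum (ρ : ℕ → ℝ) (n : ℕ) (hρ : ∀ j < n, |ρ j| ≤ 1) :
    anhPot (∑ j ∈ Finset.range n, ρ j) (∑ j ∈ Finset.range n, |ρ j|) ≤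
      (∑ j ∈ Finset.range n, anhW (∑ l ∈ Finset.range j, ρ l) (∑ l ∈ Finset.range j, |ρ l|) * ρ j)
        + (5 + 3 * Real.log (1 + n)) / 2 := by
  have key : ∀ m ≤ n, anhPot (∑ j ∈ Finset.range m, ρ j) (∑ j ∈ Finset.range m, |ρ j|) ≤
      1 + (∑ j ∈ Finset.range m,
        anhW (∑ l ∈ Finset.range j, ρ l) (∑ l ∈ Finset.range j, |ρ l|) * ρ j) +
      3 / 2 * (1 - 1 / ((∑ j ∈ Finset.range m, |ρ j|) + 1) +
        Real.log ((∑ j ∈ Finset.range m, |ρ j|) + 1)) := by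
    intro m
    induction m with
    | zero => intro _; simp [anhPot]
    | succ m ih =>
      intro hm
      have ih := ih (by omega)
      have hCn : 0 ≤ ∑ j ∈ Finset.range m, |ρ j| := Finset.sum_nonneg fun _ _ => abs_nonneg _
      have hRC : (∑ j ∈ Finset.range m, |ρ j|) = 0 → (∑ j ∈ Finset.range m, ρ j) = 0 := by
        intro h
        have := Finset.abs_sum_le_sum_abs ρ (Finset.range m)
        rw [h] at this
        exact abs_eq_zero.1 (le_antisymm this (abs_nonneg _))
      have hs := anhPot_step hCn hRC (hρ m (by omega))
      have ht := div_add_one_le_telescope hCn (abs_nonneg (ρ m)) (hρ m (by omega))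
      rw [Finset.sum_range_succ, Finset.sum_range_succ, Finset.sum_range_succ]
      linarith
  have hk := key n le_rfl
  have hCn : 0 ≤ ∑ j ∈ Finset.range n, |ρ j| := Finset.sum_nonneg fun _ _ => abs_nonneg _
  have hCle : ∑ j ∈ Finset.range n, |ρ j| ≤ n := by
    have := Finset.sum_le_card_nsmul (Finset.range n) (fun j => |ρ j|) 1
      (fun j hj => hρ j (Finset.mem_range.1 hj))
    simpa using this
  have hlog : Real.log ((∑ j ∈ Finset.range n, |ρ j|) + 1) ≤ Real.log (1 + n) :=
    Real.log_le_log (by linarith) (by linarith)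
  have hd : 0 ≤ 1 / ((∑ j ∈ Finset.range n, |ρ j|) + 1) := by positivity
  linarith

/-- Inverting the AdaNormalHedge potential. -/
lemma le_sqrt_of_anhPot_le {R C c M n : ℝ} (hCn : C ≤ n) (hRC : |R| ≤ C)
    (hM : 0 < M) (h : anhPot R C ≤ M) (hc : Real.log M ≤ c) (hc0 : 0 ≤ c) :
    R ≤ Real.sqrt (3 * n * c) := by
  rcases le_or_gt R 0 with hR | hR
  · exact hR.trans (Real.sqrt_nonneg _)
  · have hpos : 0 < C := hR.trans_le ((le_abs_self R).trans hRC)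
    apply Real.le_sqrt_of_sq_le
    unfold anhPot at h
    have h2 := ((Real.le_log_iff_exp_le hM).2 h).trans hc
    rw [div_le_iff₀ (by linarith), max_eq_left hR.le] at h2
    nlinarith

end AdaNormalHedge

section Hedge

lemma exp_neg_le_quadratic {x : ℝ} (hx : 0 ≤ x) : Real.exp (-x) ≤ 1 - x + x ^ 2 / 2 := by
  have h := Real.quadratic_le_exp_of_nonneg hx
  have hp := Real.exp_pos (-x)
  have h1 : Real.exp (-x) * Real.exp x = 1 := by rw [← Real.exp_add]; simp
  have h2 : Real.exp (-x) * (1 + x + x ^ 2 / 2) ≤ 1 :=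
    (mul_le_mul_of_nonneg_left h hp.le).trans_eq h1
  have h3 : 1 ≤ (1 - x + x ^ 2 / 2) * (1 + x + x ^ 2 / 2) := by nlinarith [sq_nonneg (x ^ 2)]
  have h4 : 0 < 1 + x + x ^ 2 / 2 := by positivity
  exact le_of_mul_le_mul_right (h2.trans h3) h4

/-- Second-moment bound for the log-partition function of losses in `[0, 1]`. -/
lemma log_sum_exp_le (S : Finset ℕ) (p ℓ : ℕ → ℝ) {α : ℝ} (hα : 0 ≤ α)
    (hp : ∀ j ∈ S, 0 < p j) (hsum : ∑ j ∈ S, p j = 1)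
    (hℓ : ∀ j ∈ S, 0 ≤ ℓ j ∧ ℓ j ≤ 1) :
    0 < ∑ j ∈ S, p j * Real.exp (-α * ℓ j) ∧
    Real.log (∑ j ∈ S, p j * Real.exp (-α * ℓ j)) ≤ -α * ∑ j ∈ S, p j * ℓ j + α ^ 2 / 2 := by
  have hne : S.Nonempty := by
    by_contra h
    rw [Finset.not_nonempty_iff_eq_empty] at h
    simp [h] at hsum
  have hpos : 0 < ∑ j ∈ S, p j * Real.exp (-α * ℓ j) :=
    Finset.sum_pos (fun j hj => mul_pos (hp j hj) (Real.exp_pos _)) hne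
  refine ⟨hpos, ?_⟩
  have hle : ∑ j ∈ S, p j * Real.exp (-α * ℓ j) ≤
      ∑ j ∈ S, (p j - α * (p j * ℓ j) + p j * (α ^ 2 / 2)) := by
    refine Finset.sum_le_sum fun j hj => ?_
    have h1 := exp_neg_le_quadratic (mul_nonneg hα (hℓ j hj).1)
    rw [← neg_mul] at h1
    have h2 : (α * ℓ j) ^ 2 ≤ α ^ 2 := by
      rw [mul_pow]
      have : ℓ j ^ 2 ≤ 1 := pow_le_one₀ (hℓ j hj).1 (hℓ j hj).2
      nlinarith [sq_nonneg α]
    have h3 := mul_le_mul_of_nonneg_left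
      (show Real.exp (-α * ℓ j) ≤ 1 - α * ℓ j + α ^ 2 / 2 by linarith) (hp j hj).le
    linarith
  rw [Finset.sum_add_distrib, Finset.sum_sub_distrib, ← Finset.mul_sum, ← Finset.sum_mul,
    hsum] at hle
  have := Real.log_le_sub_one_of_pos hpos
  linarith

/-- Positivity, normalization and regret of the Hedge weights. -/
lemma hedge_regret (S : Finset ℕ) (m : ℕ) (q ℓ : ℕ → ℕ → ℝ) {α : ℝ} (hα : 0 ≤ α)
    (hq0 : ∀ j ∈ S, 0 < q j 0) (hsum : ∑ j ∈ S, q j 0 = 1)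
    (hup : ∀ n, n + 1 < m → ∀ j ∈ S, q j (n + 1) = q j n * Real.exp (-α * ℓ j n) /
      ∑ j' ∈ S, q j' n * Real.exp (-α * ℓ j' n))
    (hℓ : ∀ n < m, ∀ j ∈ S, 0 ≤ ℓ j n ∧ ℓ j n ≤ 1) :
    (∀ n < m, (∀ j ∈ S, 0 < q j n) ∧ ∑ j ∈ S, q j n = 1) ∧
    ∀ j₀ ∈ S, α * ∑ n ∈ Finset.range m, ((∑ j ∈ S, q j n * ℓ j n) - ℓ j₀ n) ≤
      -Real.log (q j₀ 0) + m * (α ^ 2 / 2) := by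
  have hnorm : ∀ n < m, (∀ j ∈ S, 0 < q j n) ∧ ∑ j ∈ S, q j n = 1 := by
    intro n
    induction n with
    | zero => intro _; exact ⟨hq0, hsum⟩
    | succ n ih =>
      intro hn
      obtain ⟨hp, hs⟩ := ih (by omega)
      have hZ := (log_sum_exp_le S (fun j => q j n) (fun j => ℓ j n) hα hp hs
        (hℓ n (by omega))).1
      constructor
      · intro j hj
        rw [hup n hn j hj]
        exact div_pos (mul_pos (hp j hj) (Real.exp_pos _)) hZ
      · rw [Finset.sum_congr rfl (hup n hn), ← Finset.sum_div]
        exact div_self hZ.ne'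
  refine ⟨hnorm, fun j₀ hj₀ => ?_⟩
  rcases Nat.eq_zero_or_pos m with hm | hm
  · subst hm
    have h1 : q j₀ 0 ≤ 1 := by
      rw [← hsum]; exact Finset.single_le_sum (fun j hj => (hq0 j hj).le) hj₀
    have := Real.log_nonpos (hq0 j₀ hj₀).le h1
    simpa using this
  have key : ∀ n < m, α * ∑ t ∈ Finset.range n, ((∑ j ∈ S, q j t * ℓ j t) - ℓ j₀ t) ≤
      Real.log (q j₀ n) - Real.log (q j₀ 0) + n * (α ^ 2 / 2) := by
    intro n
    induction n with
    | zero => intro _; simp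
    | succ n ih =>
      intro hn
      have ih := ih (by omega)
      obtain ⟨hp, hs⟩ := hnorm n (by omega)
      obtain ⟨hZ, hlog⟩ := log_sum_exp_le S (fun j => q j n) (fun j => ℓ j n) hα hp hs
        (hℓ n (by omega))
      rw [hup n hn j₀ hj₀, Real.log_div (mul_pos (hp j₀ hj₀) (Real.exp_pos _)).ne' hZ.ne',
        Real.log_mul (hp j₀ hj₀).ne' (Real.exp_pos _).ne', Real.log_exp,
        Finset.sum_range_succ]
      push_cast
      linarith
  obtain ⟨n, rfl⟩ : ∃ n, m = n + 1 := ⟨m - 1, by omega⟩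
  have hk := key n (by omega)
  obtain ⟨hp, hs⟩ := hnorm n (by omega)
  obtain ⟨hZ, hlog⟩ := log_sum_exp_le S (fun j => q j n) (fun j => ℓ j n) hα hp hs
    (hℓ n (by omega))
  have hle : q j₀ n * Real.exp (-α * ℓ j₀ n) ≤ ∑ j ∈ S, q j n * Real.exp (-α * ℓ j n) :=
    Finset.single_le_sum (f := fun j => q j n * Real.exp (-α * ℓ j n))
      (fun j hj => (mul_pos (hp j hj) (Real.exp_pos _)).le) hj₀
  have hl := Real.log_le_log (mul_pos (hp j₀ hj₀) (Real.exp_pos _)) hle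
  rw [Real.log_mul (hp j₀ hj₀).ne' (Real.exp_pos _).ne', Real.log_exp] at hl
  rw [Finset.sum_range_succ]
  push_cast
  linarith

end Hedge

section OnlineGradientDescent

variable {E : Type*} [NormedAddCommGroup E] [InnerProductSpace ℝ E]

/-- First-order characterization of convexity. -/
lemma ConvexOn.sub_le_inner_gradient [CompleteSpace E] {f : E → ℝ}
    (hf : ConvexOn ℝ Set.univ f) {x : E} (hx : DifferentiableAt ℝ f x) (z : E) :
    f x - f z ≤ inner ℝ (gradient f x) (x - z) := by
  have hc : ConvexOn ℝ Set.univ (f ∘ AffineMap.lineMap (k := ℝ) x z) := by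
    simpa using hf.comp_affineMap (AffineMap.lineMap (k := ℝ) x z)
  have hd : HasDerivAt (f ∘ AffineMap.lineMap (k := ℝ) x z) (fderiv ℝ f x (z - x)) 0 := by
    have h1 : HasDerivAt (AffineMap.lineMap (k := ℝ) x z) (z - x) (0 : ℝ) :=
      AffineMap.hasDerivAt_lineMap
    have h2 : HasFDerivAt f (fderiv ℝ f x) (AffineMap.lineMap (k := ℝ) x z (0 : ℝ)) := by
      simpa using hx.hasFDerivAt
    exact h2.comp_hasDerivAt 0 h1
  have h := hc.le_slope_of_hasDerivAt (Set.mem_univ 0) (Set.mem_univ 1) one_pos hd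
  rw [slope_def_field] at h
  simp only [Function.comp, AffineMap.lineMap_apply_one, AffineMap.lineMap_apply_zero, sub_zero,
    div_one] at h
  rw [← inner_gradient_left] at h
  have : inner ℝ (gradient f x) (x - z) = -inner ℝ (gradient f x) (z - x) := by
    rw [← inner_neg_right, neg_sub]
  linarith

lemma norm_proj_sub_sq_le {Ω : Set E} (hconv : Convex ℝ Ω) {z p v : E} (hp : p ∈ Ω)
    (hmin : ∀ z' ∈ Ω, ‖p - z‖ ≤ ‖z' - z‖) (hv : v ∈ Ω) : ‖p - v‖ ^ 2 ≤ ‖z - v‖ ^ 2 := by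
  have hinf : ‖z - p‖ = ⨅ w : Ω, ‖z - w‖ := by
    have : Nonempty Ω := ⟨⟨p, hp⟩⟩
    apply le_antisymm
    · refine le_ciInf fun w => ?_
      rw [norm_sub_rev z p, norm_sub_rev z w]
      exact hmin w w.2
    · exact ciInf_le ⟨0, by rintro _ ⟨w, rfl⟩; exact norm_nonneg _⟩ (⟨p, hp⟩ : Ω)
  have h := (norm_eq_iInf_iff_real_inner_le_zero hconv hp).1 hinf v hv
  have e : z - v = (z - p) - (v - p) := by abel
  have := norm_sub_sq_real (z - p) (v - p)
  rw [← e, norm_sub_rev v p] at this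
  nlinarith [sq_nonneg ‖z - p‖]

/-- Dynamic regret of projected online gradient descent. -/
lemma ogd_dynamic_regret {Ω : Set E} (hconv : Convex ℝ Ω) {D G η : ℝ}
    (hdiam : ∀ z ∈ Ω, ∀ z' ∈ Ω, ‖z - z'‖ ≤ D) {proj : E → E}
    (hproj : ∀ z, proj z ∈ Ω ∧ ∀ z' ∈ Ω, ‖proj z - z‖ ≤ ‖z' - z‖)
    (m : ℕ) (y g u : ℕ → E) (hy : ∀ n < m + 1, y n ∈ Ω)
    (hyup : ∀ n, n + 1 < m + 1 → y (n + 1) = proj (y n - η • g n))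
    (hg : ∀ n < m + 1, ‖g n‖ ≤ G) (hu : ∀ n < m + 1, u n ∈ Ω) :
    2 * η * ∑ n ∈ Finset.range (m + 1), inner ℝ (g n) (y n - u n) ≤
      D ^ 2 + 2 * D * ∑ n ∈ Finset.range m, ‖u (n + 1) - u n‖ + (m + 1) * (η ^ 2 * G ^ 2) := by
  have step : ∀ n < m + 1, 2 * η * inner ℝ (g n) (y n - u n) ≤
      ‖y n - u n‖ ^ 2 - ‖proj (y n - η • g n) - u n‖ ^ 2 + η ^ 2 * G ^ 2 := by
    intro n hn
    have h1 := norm_proj_sub_sq_le hconv (hproj (y n - η • g n)).1 (hproj (y n - η • g n)).2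
      (hu n hn)
    have e : y n - η • g n - u n = (y n - u n) - η • g n := by abel
    rw [e, norm_sub_sq_real (y n - u n), inner_smul_right, norm_smul, Real.norm_eq_abs,
      mul_pow, sq_abs, real_inner_comm] at h1
    have h2 : ‖g n‖ ^ 2 ≤ G ^ 2 := pow_le_pow_left₀ (norm_nonneg _) (hg n hn) 2
    nlinarith [mul_le_mul_of_nonneg_left h2 (sq_nonneg η)]
  have key : ∀ n < m + 1, 2 * η * ∑ j ∈ Finset.range (n + 1), inner ℝ (g j) (y j - u j) ≤
      D ^ 2 + 2 * D * ∑ j ∈ Finset.range n, ‖u (j + 1) - u j‖ + (n + 1) * (η ^ 2 * G ^ 2) -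
        ‖proj (y n - η • g n) - u n‖ ^ 2 := by
    intro n
    induction n with
    | zero =>
      intro hn
      have h1 := step 0 hn
      have h2 : ‖y 0 - u 0‖ ^ 2 ≤ D ^ 2 :=
        pow_le_pow_left₀ (norm_nonneg _) (hdiam _ (hy 0 hn) _ (hu 0 hn)) 2
      simp only [zero_add, Finset.sum_range_one, Finset.sum_range_zero]
      push_cast
      linarith
    | succ n ih =>
      intro hn
      have ih := ih (by omega)
      have h1 := step (n + 1) hn
      rw [← hyup n hn] at ih
      rw [Finset.sum_range_succ, Finset.sum_range_succ (fun j => ‖u (j + 1) - u j‖)]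
      have a0 := hdiam _ (hy _ hn) _ (hu n (by omega))
      have b0 := hdiam _ (hy _ hn) _ (hu _ hn)
      have tri : ‖y (n + 1) - u (n + 1)‖ ≤ ‖y (n + 1) - u n‖ + ‖u (n + 1) - u n‖ := by
        have : y (n + 1) - u (n + 1) = (y (n + 1) - u n) - (u (n + 1) - u n) := by abel
        rw [this]; exact norm_sub_le _ _
      have h3 : ‖y (n + 1) - u (n + 1)‖ ^ 2 ≤ ‖y (n + 1) - u n‖ ^ 2 +
          2 * D * ‖u (n + 1) - u n‖ := by
        have n1 := norm_nonneg (y (n + 1) - u (n + 1))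
        have n2 := norm_nonneg (y (n + 1) - u n)
        have n3 := norm_nonneg (u (n + 1) - u n)
        rcases le_total ‖y (n + 1) - u (n + 1)‖ ‖y (n + 1) - u n‖ with h | h
        · have : 0 ≤ D := n1.trans b0
          nlinarith [mul_nonneg this n3]
        · nlinarith [mul_le_mul (sub_le_iff_le_add'.2 tri) (add_le_add a0 b0) (by linarith) n3]
      push_cast
      linarith
  have := key m (by omega)
  nlinarith [sq_nonneg ‖proj (y m - η • g m) - u m‖]

end OnlineGradientDescent

section GeometricCovering

lemma sqrt_add_mul_sqrt_le {M x : ℝ} (hx : 0 ≤ x) (hxM : x ≤ M) :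
    Real.sqrt M + 5 / 2 * Real.sqrt x ≤ 5 / 2 * Real.sqrt (M + x) := by
  have hM : 0 ≤ M := hx.trans hxM
  have a0 := Real.sqrt_nonneg M
  have b0 := Real.sqrt_nonneg x
  have ab : Real.sqrt x ≤ Real.sqrt M := Real.sqrt_le_sqrt hxM
  have a2 := Real.sq_sqrt hM
  have b2 := Real.sq_sqrt hx
  have : 2 / 5 * Real.sqrt M + Real.sqrt x ≤ Real.sqrt (M + x) := by
    apply Real.le_sqrt_of_sq_le
    nlinarith [mul_nonneg a0 (sub_nonneg.2 ab)]
  linarith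

lemma sqrt_mul_add_sqrt_mul_le {a b p q P : ℝ} (ha : 0 ≤ a) (hb : 0 ≤ b) (hp : 0 ≤ p)
    (hq : 0 ≤ q) (hP : p + q ≤ P) :
    Real.sqrt (a * p) + Real.sqrt (b * q) ≤ Real.sqrt ((a + b) * P) := by
  apply Real.le_sqrt_of_sq_le
  rw [Real.sqrt_mul ha, Real.sqrt_mul hb]
  have ha2 := Real.sq_sqrt ha
  have hb2 := Real.sq_sqrt hb
  have hp2 := Real.sq_sqrt hp
  have hq2 := Real.sq_sqrt hq
  set A := Real.sqrt a
  set B := Real.sqrt b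
  set X := Real.sqrt p
  set Y := Real.sqrt q
  have h1 : (A * X + B * Y) ^ 2 ≤ (A ^ 2 + B ^ 2) * (X ^ 2 + Y ^ 2) := by
    nlinarith [sq_nonneg (A * Y - B * X)]
  rw [ha2, hb2, hp2, hq2] at h1
  exact h1.trans (mul_le_mul_of_nonneg_left hP (add_nonneg ha hb))

/-- Every interval `[r, S]` of positive integers has a point whose dyadic valuation dominates the
distances to both ends. -/
lemma exists_dyadic_center {r S : ℕ} (hr : 1 ≤ r) (hrS : r ≤ S) :
    ∃ k m, r ≤ m ∧ m ≤ S ∧ 2 ^ k ∣ m ∧ m < r + 2 ^ k ∧ S < m + 2 ^ k := by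
  classical
  let Q : ℕ → Prop := fun k => ∃ m, r ≤ m ∧ m ≤ S ∧ 2 ^ k ∣ m
  have hbig : ∀ k, Q k → k < S := by
    rintro k ⟨m, h1, h2, h3⟩
    have := Nat.le_of_dvd (by omega) h3
    have := Nat.lt_two_pow_self (n := k)
    omega
  have hQ0 : Q 0 := ⟨r, le_rfl, hrS, by simp⟩
  have hk : Q (Nat.findGreatest Q S) := Nat.findGreatest_spec (Nat.zero_le S) hQ0
  have hk1 : ¬ Q (Nat.findGreatest Q S + 1) := fun h =>
    Nat.findGreatest_is_greatest (Nat.lt_succ_self _) (hbig _ h).le h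
  set k := Nat.findGreatest Q S
  obtain ⟨m, h1, h2, c, hc⟩ := hk
  have hpos : 0 < 2 ^ k := by positivity
  have hodd : c % 2 = 1 := by
    by_contra hne
    apply hk1
    refine ⟨m, h1, h2, c / 2, ?_⟩
    rw [hc, pow_succ, mul_assoc]
    congr 1; omega
  refine ⟨k, m, h1, h2, ⟨c, hc⟩, ?_, ?_⟩
  · by_contra hlt
    apply hk1
    refine ⟨m - 2 ^ k, by omega, by omega, c / 2, ?_⟩
    have : c = 2 * (c / 2) + 1 := by omega
    rw [hc, pow_succ, mul_assoc]
    conv_lhs => rw [this]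
    rw [mul_add, mul_one, Nat.add_sub_cancel]
  · by_contra hlt
    apply hk1
    refine ⟨m + 2 ^ k, by omega, by omega, c / 2 + 1, ?_⟩
    have : c = 2 * (c / 2) + 1 := by omega
    rw [hc, pow_succ, mul_assoc]
    conv_lhs => rw [this]
    ring

/-- Passing from geometric covering intervals to arbitrary intervals: if the additive interval
function `F` is controlled on every geometric covering interval inside `[r, S)`, it is controlled
on `[r, S)`. -/
lemma le_of_le_on_covering_intervals {F P : ℕ → ℕ → ℝ} {r S : ℕ} {c e : ℝ} (hr : 1 ≤ r)
    (hrS : r ≤ S) (hc : 0 ≤ c) (he : 0 ≤ e)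
    (hF : ∀ a b d, a ≤ b → b ≤ d → F a d = F a b + F b d) (hP0 : ∀ a b, 0 ≤ P a b)
    (hP : ∀ a b d, a ≤ b → b ≤ d → P a b + P b d ≤ P a d)
    (hbase : ∀ k i, 1 ≤ i → r ≤ i * 2 ^ k → (i + 1) * 2 ^ k ≤ S →
      F (i * 2 ^ k) ((i + 1) * 2 ^ k) ≤
        c * Real.sqrt (2 ^ k) + e * Real.sqrt (2 ^ k * P (i * 2 ^ k) ((i + 1) * 2 ^ k))) :
    F r S ≤ 5 * c * Real.sqrt ((S : ℝ) - r) + e * Real.sqrt (((S : ℝ) - r) * P r S) := by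
  have hF0 : ∀ a, F a a = 0 := fun a => by
    have := hF a a a le_rfl le_rfl
    linarith
  have hbase' : ∀ k a, r ≤ a → a + 2 ^ k ≤ S → 2 ^ k ∣ a →
      F a (a + 2 ^ k) ≤ c * Real.sqrt (2 ^ k) + e * Real.sqrt (2 ^ k * P a (a + 2 ^ k)) := by
    rintro k a hra haS ⟨i, rfl⟩
    have := hbase k i (Nat.pos_of_ne_zero fun h => by subst h; omega)
      (by rwa [mul_comm]) (by rwa [add_mul, one_mul, mul_comm])
    rwa [add_mul, one_mul, mul_comm i] at this
  have combine : ∀ {X Y M x p q R : ℝ}, 0 ≤ x → x ≤ M → 0 ≤ p → 0 ≤ q → p + q ≤ R →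
      X ≤ c * Real.sqrt M + e * Real.sqrt (M * p) →
      Y ≤ 5 / 2 * c * Real.sqrt x + e * Real.sqrt (x * q) →
      X + Y ≤ 5 / 2 * c * Real.sqrt (M + x) + e * Real.sqrt ((M + x) * R) := by
    intro X Y M x p q R hx hxM hp hq hR hX hY
    have h1 := mul_le_mul_of_nonneg_left (sqrt_add_mul_sqrt_le hx hxM) hc
    have h2 := mul_le_mul_of_nonneg_left
      (sqrt_mul_add_sqrt_mul_le (hx.trans hxM) hx hp hq hR) he
    linarith
  have right : ∀ k a b, r ≤ a → b ≤ S → 2 ^ k ∣ a → a ≤ b → b < a + 2 ^ k →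
      F a b ≤ 5 / 2 * c * Real.sqrt ((b : ℝ) - a) + e * Real.sqrt (((b : ℝ) - a) * P a b) := by
    intro k
    induction k with
    | zero =>
      intro a b _ _ _ h1 h2
      obtain rfl : a = b := by omega
      simp [hF0]
    | succ k ih =>
      intro a b hra hbS hdvd hab hb
      have hdvd' : 2 ^ k ∣ a := (pow_dvd_pow 2 (Nat.le_succ k)).trans hdvd
      rw [pow_succ] at hb
      rcases lt_or_ge b (a + 2 ^ k) with h | h
      · exact ih a b hra hbS hdvd' hab h
      · have h1 := hbase' k a hra (h.trans hbS) hdvd'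
        have h2 := ih (a + 2 ^ k) b (by omega) hbS (hdvd'.add dvd_rfl) h (by omega)
        have hx : (0 : ℝ) ≤ (b : ℝ) - (a + 2 ^ k : ℕ) := by
          rw [sub_nonneg]; exact_mod_cast h
        have hxM : (b : ℝ) - (a + 2 ^ k : ℕ) ≤ 2 ^ k := by
          rw [sub_le_iff_le_add]; exact_mod_cast (by omega : b ≤ 2 ^ k + (a + 2 ^ k))
        have := combine hx hxM (hP0 _ _) (hP0 _ _) (hP a (a + 2 ^ k) b (by omega) h) h1 h2
        rw [← hF a (a + 2 ^ k) b (by omega) h] at this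
        have e1 : (2 : ℝ) ^ k + ((b : ℝ) - (a + 2 ^ k : ℕ)) = b - a := by push_cast; ring
        rwa [e1] at this
  have left : ∀ k a b, r ≤ a → b ≤ S → 2 ^ k ∣ b → a ≤ b → b < a + 2 ^ k →
      F a b ≤ 5 / 2 * c * Real.sqrt ((b : ℝ) - a) + e * Real.sqrt (((b : ℝ) - a) * P a b) := by
    intro k
    induction k with
    | zero =>
      intro a b _ _ _ h1 h2
      obtain rfl : a = b := by omega
      simp [hF0]
    | succ k ih =>
      intro a b hra hbS hdvd hab hb
      have hdvd' : 2 ^ k ∣ b := (pow_dvd_pow 2 (Nat.le_succ k)).trans hdvd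
      rw [pow_succ] at hb
      rcases lt_or_ge b (a + 2 ^ k) with h | h
      · exact ih a b hra hbS hdvd' hab h
      · obtain ⟨z, rfl⟩ : ∃ z, b = z + 2 ^ k := ⟨b - 2 ^ k, by omega⟩
        have hz : 2 ^ k ∣ z := (Nat.dvd_add_left dvd_rfl).1 hdvd'
        have h1 := hbase' k z (by omega) hbS hz
        have h2 := ih a z hra (by omega) hz (by omega) (by omega)
        have haz : a ≤ z := by omega
        have hx : (0 : ℝ) ≤ (z : ℝ) - a := by
          rw [sub_nonneg]; exact_mod_cast haz
        have hxM : (z : ℝ) - a ≤ 2 ^ k := by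
          rw [sub_le_iff_le_add]; exact_mod_cast (by omega : z ≤ 2 ^ k + a)
        have hPP := hP a z (z + 2 ^ k) haz (by omega)
        rw [add_comm] at hPP
        have := combine hx hxM (hP0 _ _) (hP0 _ _) hPP h1 h2
        rw [add_comm (F z _), ← hF a z (z + 2 ^ k) haz (by omega)] at this
        have e1 : (2 : ℝ) ^ k + ((z : ℝ) - a) = (z + 2 ^ k : ℕ) - a := by push_cast; ring
        rwa [e1] at this
  obtain ⟨k, m, hrm, hmS, hdvd, h1, h2⟩ := exists_dyadic_center hr hrS
  have hl := left k r m le_rfl hmS hdvd hrm h1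
  have hr' := right k m S hrm le_rfl hdvd hmS h2
  rw [hF r m S hrm hmS]
  have hrm' : (r : ℝ) ≤ m := by exact_mod_cast hrm
  have hmS' : (m : ℝ) ≤ S := by exact_mod_cast hmS
  have s1 : Real.sqrt ((m : ℝ) - r) ≤ Real.sqrt ((S : ℝ) - r) := Real.sqrt_le_sqrt (by linarith)
  have s2 : Real.sqrt ((S : ℝ) - m) ≤ Real.sqrt ((S : ℝ) - r) := Real.sqrt_le_sqrt (by linarith)
  have s3 := sqrt_mul_add_sqrt_mul_le (sub_nonneg.2 hrm') (sub_nonneg.2 hmS') (hP0 r m) (hP0 m S)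
    (hP r m S hrm hmS)
  rw [show (m : ℝ) - r + (S - m) = S - r by ring] at s3
  have t1 := mul_le_mul_of_nonneg_left s1 hc
  have t2 := mul_le_mul_of_nonneg_left s2 hc
  have t3 := mul_le_mul_of_nonneg_left s3 he
  linarith

end GeometricCovering

section Ader

variable {E : Type*} [NormedAddCommGroup E] [InnerProductSpace ℝ E]

lemma aderN_pos (m : ℕ) : 1 ≤ aderN m := Nat.le_add_left _ _

lemma sum_ader_weights {N : ℕ} (hN : 1 ≤ N) :
    ∑ j ∈ Finset.Icc 1 N, (1 + 1 / (N : ℝ)) / ((j : ℝ) * ((j : ℝ) + 1)) = 1 := by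
  have h : ∀ n : ℕ, ∑ j ∈ Finset.Icc 1 n, 1 / ((j : ℝ) * ((j : ℝ) + 1)) = n / (n + 1) := by
    intro n
    induction n with
    | zero => simp
    | succ n ih =>
      rw [Finset.sum_Icc_succ_top (by omega), ih]
      push_cast
      field_simp
      ring
  have hN' : (0 : ℝ) < N := by exact_mod_cast hN
  calc _ = (1 + 1 / (N : ℝ)) * ∑ j ∈ Finset.Icc 1 N, 1 / ((j : ℝ) * ((j : ℝ) + 1)) := by
        rw [Finset.mul_sum]; exact Finset.sum_congr rfl fun j _ => by ring
    _ = 1 := by rw [h]; field_simp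

/-- The index of the best step size satisfies `h ≤ √X < 2h` with `h` the selected power of two. -/
lemma two_pow_floor_logb_half {X : ℝ} (hX : 1 ≤ X) :
    (2 : ℝ) ^ ⌊Real.logb 2 X / 2⌋₊ ≤ Real.sqrt X ∧
      Real.sqrt X ≤ 2 * 2 ^ ⌊Real.logb 2 X / 2⌋₊ := by
  have hX0 : 0 < X := by linarith
  have hlog : 0 ≤ Real.logb 2 X / 2 := by
    have := Real.logb_nonneg (b := 2) (by norm_num) hX
    positivity
  have hs : Real.sqrt X = (2 : ℝ) ^ (Real.logb 2 X / 2) := by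
    rw [div_eq_mul_one_div, Real.rpow_mul (by norm_num),
      Real.rpow_logb (by norm_num) (by norm_num) hX0, Real.sqrt_eq_rpow]
  rw [hs, ← Real.rpow_natCast]
  constructor
  · exact Real.rpow_le_rpow_of_exponent_le (by norm_num) (Nat.floor_le hlog)
  · calc (2 : ℝ) ^ (Real.logb 2 X / 2) ≤ 2 ^ (1 + (⌊Real.logb 2 X / 2⌋₊ : ℝ)) :=
          Real.rpow_le_rpow_of_exponent_le (by norm_num)
            (by linarith [Nat.lt_floor_add_one (Real.logb 2 X / 2)])
      _ = _ := by rw [Real.rpow_add (by norm_num), Real.rpow_one]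

/-- The step size with the selected index balances the two terms of the OGD regret bound. -/
lemma ogd_tuned_bound {D G P σ : ℝ} (hD : 0 < D) (hG : 0 < G) (hP : 0 ≤ P) (hσ : 0 < σ)
    {η B : ℝ}
    (hη : η = 2 ^ ⌊Real.logb 2 (1 + 4 * P / (7 * D)) / 2⌋₊ * (D / G) *
      (Real.sqrt (7 / 2) / σ))
    (hB : 2 * η * B ≤ D ^ 2 + 2 * D * P + σ ^ 2 * (η ^ 2 * G ^ 2)) :
    B ≤ 3 * G * D * σ + 3 * G * Real.sqrt D * (σ * Real.sqrt P) := by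
  have hPD : 0 ≤ 4 * P / (7 * D) := by positivity
  have hX : 1 ≤ 1 + 4 * P / (7 * D) := by linarith
  obtain ⟨h1, h2⟩ := two_pow_floor_logb_half hX
  have hXD : D ^ 2 * (1 + 4 * P / (7 * D)) = D ^ 2 + 4 / 7 * (D * P) := by field_simp
  have hx2 := Real.sq_sqrt (show 0 ≤ 1 + 4 * P / (7 * D) by linarith)
  have hx0 := Real.sqrt_nonneg (1 + 4 * P / (7 * D))
  have hh : (0 : ℝ) < 2 ^ ⌊Real.logb 2 (1 + 4 * P / (7 * D)) / 2⌋₊ := by positivity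
  have hc2 : Real.sqrt (7 / 2) ^ 2 = 7 / 2 := Real.sq_sqrt (by norm_num)
  have hc0 : 0 < Real.sqrt (7 / 2) := Real.sqrt_pos.2 (by norm_num)
  have hc19 : Real.sqrt (7 / 2) ≤ 1.9 := by
    rw [Real.sqrt_le_left (by norm_num)]; norm_num
  have hDx : D * Real.sqrt (1 + 4 * P / (7 * D)) ≤ D + Real.sqrt D * Real.sqrt P := by
    refine le_of_pow_le_pow_left₀ two_ne_zero (by positivity) ?_
    rw [mul_pow, hx2, hXD, add_sq, mul_pow, Real.sq_sqrt hD.le, Real.sq_sqrt hP]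
    have : 0 ≤ D * P := by positivity
    have : 0 ≤ 2 * D * (Real.sqrt D * Real.sqrt P) := by positivity
    linarith
  set x := Real.sqrt (1 + 4 * P / (7 * D))
  set h := (2 : ℝ) ^ ⌊Real.logb 2 (1 + 4 * P / (7 * D)) / 2⌋₊
  set c := Real.sqrt (7 / 2)
  have hηpos : 0 < η := by rw [hη]; positivity
  have hηG : η * G * σ = h * D * c := by rw [hη]; field_simp
  have hB' : 2 * (h * D * c) * B ≤ (7 / 2 * (D * x) ^ 2 + (h * D * c) ^ 2) * (G * σ) := by
    have e : σ ^ 2 * (η ^ 2 * G ^ 2) = (h * D * c) ^ 2 := by rw [← hηG]; ring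
    rw [e] at hB
    have e2 : 2 * (h * D * c) * B = 2 * η * B * (G * σ) := by rw [← hηG]; ring
    rw [e2]
    apply mul_le_mul_of_nonneg_right _ (by positivity)
    refine hB.trans ?_
    rw [mul_pow D x, hx2, hXD]
    linarith [sq_nonneg D]
  have hkey : (7 / 2 * (D * x) ^ 2 + (h * D * c) ^ 2) * (G * σ) ≤
      2 * (h * D * c) * (3 * (G * σ) * (D * x)) := by
    have : 7 / 2 * x ^ 2 + (h * c) ^ 2 ≤ 6 * h * c * x := by
      have a1 : 7 / 2 * x ^ 2 ≤ c ^ 2 * (2 * h * x) := by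
        rw [hc2]; nlinarith
      have a2 : (h * c) ^ 2 ≤ c ^ 2 * (h * x) := by
        nlinarith [mul_le_mul_of_nonneg_left h1 hh.le, sq_nonneg c]
      have a3 : c * (c * (h * x)) ≤ 1.9 * (c * (h * x)) :=
        mul_le_mul_of_nonneg_right hc19 (by positivity)
      have a4 : 0 ≤ c * (h * x) := by positivity
      nlinarith
    have := mul_le_mul_of_nonneg_left this (show 0 ≤ D ^ 2 * (G * σ) by positivity)
    nlinarith
  have hfin : B ≤ 3 * (G * σ) * (D * x) :=
    le_of_mul_le_mul_left (hB'.trans hkey) (by positivity)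
  have := mul_le_mul_of_nonneg_left hDx (show 0 ≤ 3 * (G * σ) by positivity)
  nlinarith

/-- Ader's actions remain in the domain, and its Hedge weights stay a probability vector. -/
lemma ader_invariants {Ω : Set E} {D G : ℝ} {proj : E → E} (hproj : ∀ z, proj z ∈ Ω)
    (m : ℕ) (h : ℕ → E → ℝ) (hrange : ∀ n, ∀ z ∈ Ω, 0 ≤ h n z ∧ h n z ≤ 1)
    (grad : ℕ → E → E) (y : ℕ → ℕ → E) (q : ℕ → ℕ → ℝ) (hy0 : ∀ j, y j 0 ∈ Ω)
    (hyup : ∀ j n, n + 1 < m → y j (n + 1) = proj (y j n - aderEta D G m j • grad n (y j n)))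
    (hq0 : ∀ j, 1 ≤ j → j ≤ aderN m →
      q j 0 = (1 + 1 / (aderN m : ℝ)) / ((j : ℝ) * ((j : ℝ) + 1)))
    (hqup : ∀ j n, n + 1 < m → q j (n + 1) = q j n * Real.exp (-(aderAlpha m) * h n (y j n)) /
      ∑ j' ∈ Finset.Icc 1 (aderN m), q j' n * Real.exp (-(aderAlpha m) * h n (y j' n))) :
    (∀ j, ∀ n < m, y j n ∈ Ω) ∧
    (∀ n < m, (∀ j ∈ Finset.Icc 1 (aderN m), 0 < q j n) ∧
      ∑ j ∈ Finset.Icc 1 (aderN m), q j n = 1) ∧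
    ∀ j₀ ∈ Finset.Icc 1 (aderN m), aderAlpha m * ∑ n ∈ Finset.range m,
      ((∑ j ∈ Finset.Icc 1 (aderN m), q j n * h n (y j n)) - h n (y j₀ n)) ≤
        -Real.log (q j₀ 0) + m * (aderAlpha m ^ 2 / 2) := by
  have hy : ∀ j, ∀ n < m, y j n ∈ Ω := by
    intro j n hn
    cases n with
    | zero => exact hy0 j
    | succ n => rw [hyup j n hn]; exact hproj _
  refine ⟨hy, hedge_regret _ m q (fun j n => h n (y j n)) (Real.sqrt_nonneg _) ?_ ?_
    (fun n hn j _ => hqup j n hn) (fun n hn j _ => hrange n _ (hy j n hn))⟩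
  · intro j hj
    obtain ⟨h1, h2⟩ := Finset.mem_Icc.1 hj
    rw [hq0 j h1 h2]
    have : (0 : ℝ) < j := by exact_mod_cast h1
    positivity
  · rw [← sum_ader_weights (aderN_pos m)]
    exact Finset.sum_congr rfl fun j hj =>
      hq0 j (Finset.mem_Icc.1 hj).1 (Finset.mem_Icc.1 hj).2

/-- Dynamic regret of Ader with horizon `M + 1`. -/
lemma ader_dynamic_regret [CompleteSpace E] {Ω : Set E} {D G : ℝ} (hD : 0 < D) (hG : 0 < G)
    (hconv : Convex ℝ Ω) (hdiam : ∀ z ∈ Ω, ∀ z' ∈ Ω, ‖z - z'‖ ≤ D) {proj : E → E}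
    (hproj : ∀ z, proj z ∈ Ω ∧ ∀ z' ∈ Ω, ‖proj z - z‖ ≤ ‖z' - z‖)
    (M : ℕ) (h : ℕ → E → ℝ) (hfconv : ∀ n, ConvexOn ℝ Set.univ (h n))
    (hfdiff : ∀ n z, DifferentiableAt ℝ (h n) z)
    (hgrad : ∀ n, ∀ z ∈ Ω, ‖gradient (h n) z‖ ≤ G)
    (hrange : ∀ n, ∀ z ∈ Ω, 0 ≤ h n z ∧ h n z ≤ 1)
    (y : ℕ → ℕ → E) (q : ℕ → ℕ → ℝ) (hy0 : ∀ j, y j 0 ∈ Ω)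
    (hyup : ∀ j n, n + 1 < M + 1 →
      y j (n + 1) = proj (y j n - aderEta D G (M + 1) j • gradient (h n) (y j n)))
    (hq0 : ∀ j, 1 ≤ j → j ≤ aderN (M + 1) →
      q j 0 = (1 + 1 / (aderN (M + 1) : ℝ)) / ((j : ℝ) * ((j : ℝ) + 1)))
    (hqup : ∀ j n, n + 1 < M + 1 →
      q j (n + 1) = q j n * Real.exp (-(aderAlpha (M + 1)) * h n (y j n)) /
      ∑ j' ∈ Finset.Icc 1 (aderN (M + 1)),
        q j' n * Real.exp (-(aderAlpha (M + 1)) * h n (y j' n)))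
    (v : ℕ → E) (hv : ∀ n < M + 1, v n ∈ Ω) {P : ℝ}
    (hP : P = ∑ n ∈ Finset.range M, ‖v (n + 1) - v n‖) :
    ∑ n ∈ Finset.range (M + 1),
      (h n (∑ j ∈ Finset.Icc 1 (aderN (M + 1)), q j n • y j n) - h n (v n)) ≤
      (3 / 2 + Real.log (((⌊Real.logb 2 (1 + 4 * P / (7 * D)) / 2⌋₊ + 1 : ℕ) : ℝ) + 1) +
        3 * D * G) * Real.sqrt ((M : ℝ) + 1) +
      3 * G * Real.sqrt D * (Real.sqrt ((M : ℝ) + 1) * Real.sqrt P) := by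
  obtain ⟨hy, hq, hhedge⟩ := ader_invariants (grad := fun n => gradient (h n))
    (fun z => (hproj z).1) (M + 1) h hrange y q hy0 hyup hq0 hqup
  have hP0 : 0 ≤ P := by rw [hP]; exact Finset.sum_nonneg fun _ _ => norm_nonneg _
  have hPM : P ≤ M * D := by
    rw [hP]
    have := Finset.sum_le_card_nsmul (Finset.range M) (fun n => ‖v (n + 1) - v n‖) D
      (fun n hn => by
        have := Finset.mem_range.1 hn
        exact hdiam _ (hv _ (by omega)) _ (hv _ (by omega)))
    simpa using this
  set κ := ⌊Real.logb 2 (1 + 4 * P / (7 * D)) / 2⌋₊ + 1 with hκ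
  have hκ1 : 1 ≤ κ := Nat.le_add_left _ _
  have hκN : κ ≤ aderN (M + 1) := by
    unfold aderN
    rw [hκ]
    apply Nat.add_le_add_right
    refine (Nat.floor_le_ceil _).trans (Nat.ceil_mono ?_)
    have h1 : 4 * P / (7 * D) ≤ 4 * ((M + 1 : ℕ) : ℝ) / 7 := by
      rw [div_le_div_iff₀ (by positivity) (by norm_num)]
      push_cast
      nlinarith
    have h2 : 0 ≤ 4 * P / (7 * D) := by positivity
    have := Real.logb_le_logb_of_le (b := 2) (by norm_num) (by linarith)
      (add_le_add_right h1 1)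
    linarith
  have hκm : κ ∈ Finset.Icc 1 (aderN (M + 1)) := Finset.mem_Icc.2 ⟨hκ1, hκN⟩
  have hσ2 : Real.sqrt ((M : ℝ) + 1) ^ 2 = (M : ℝ) + 1 := Real.sq_sqrt (by positivity)
  have hσ : 0 < Real.sqrt ((M : ℝ) + 1) := Real.sqrt_pos.2 (by positivity)
  set σ := Real.sqrt ((M : ℝ) + 1) with hσdef
  have hexpert : ∑ n ∈ Finset.range (M + 1), (h n (y κ n) - h n (v n)) ≤
      3 * G * D * σ + 3 * G * Real.sqrt D * (σ * Real.sqrt P) := by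
    have hogd := ogd_dynamic_regret hconv hdiam hproj M (y κ) (fun n => gradient (h n) (y κ n)) v
      (hy κ) (hyup κ) (fun n hn => hgrad n _ (hy κ n hn)) hv
    refine le_trans (Finset.sum_le_sum fun n _ =>
      (hfconv n).sub_le_inner_gradient (hfdiff n _) (v n)) ?_
    refine ogd_tuned_bound hD hG hP0 hσ (η := aderEta D G (M + 1) κ) ?_ ?_
    · unfold aderEta
      rw [hκ, Nat.add_sub_cancel, hσdef, ← Real.sqrt_div (by norm_num)]
      congr 2
      push_cast
      field_simp
    · rw [hσ2, hP]; exact hogd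
  have hmeta : ∑ n ∈ Finset.range (M + 1),
      ((∑ j ∈ Finset.Icc 1 (aderN (M + 1)), q j n * h n (y j n)) - h n (y κ n)) ≤
      (3 / 2 + Real.log ((κ : ℝ) + 1)) * σ := by
    have hh := hhedge κ hκm
    have hα : aderAlpha (M + 1) = Real.sqrt 8 / σ := by
      unfold aderAlpha
      rw [hσdef, ← Real.sqrt_div (by norm_num)]; push_cast; rfl
    have h8 : Real.sqrt 8 ^ 2 = 8 := Real.sq_sqrt (by norm_num)
    have h8' : 8 / 3 ≤ Real.sqrt 8 := Real.le_sqrt_of_sq_le (by norm_num)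
    have hα2 : ((M + 1 : ℕ) : ℝ) * (aderAlpha (M + 1) ^ 2 / 2) = 4 := by
      rw [hα, div_pow, h8, hσ2]; push_cast; field_simp; norm_num
    have hκ0 : (0 : ℝ) < κ := by exact_mod_cast hκ1
    have hlog : -Real.log (q κ 0) ≤ 2 * Real.log ((κ : ℝ) + 1) := by
      rw [hq0 κ hκ1 hκN, ← Real.log_inv, inv_div,
        show 2 * Real.log ((κ : ℝ) + 1) = Real.log (((κ : ℝ) + 1) ^ 2) by
          rw [Real.log_pow]; norm_num]
      apply Real.log_le_log (by positivity)
      have : (0 : ℝ) ≤ 1 / (aderN (M + 1) : ℝ) := by positivity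
      rw [div_le_iff₀ (by positivity)]
      nlinarith [sq_nonneg ((κ : ℝ) + 1), mul_nonneg (sq_nonneg ((κ : ℝ) + 1)) this]
    have hlog0 : 0 ≤ Real.log ((κ : ℝ) + 1) := Real.log_nonneg (by linarith)
    rw [hα2, hα, div_mul_eq_mul_div, div_le_iff₀ hσ] at hh
    set X := ∑ n ∈ Finset.range (M + 1),
      ((∑ j ∈ Finset.Icc 1 (aderN (M + 1)), q j n * h n (y j n)) - h n (y κ n))
    by_contra hlt
    push Not at hlt
    have h0 : 0 ≤ (3 / 2 + Real.log ((κ : ℝ) + 1)) * σ := by positivity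
    have a1 := mul_le_mul_of_nonneg_right h8' (h0.trans hlt.le)
    have a2 := mul_le_mul_of_nonneg_right hlog hσ.le
    have a3 := mul_nonneg hlog0 hσ.le
    nlinarith
  have hjensen : ∀ n ∈ Finset.range (M + 1),
      h n (∑ j ∈ Finset.Icc 1 (aderN (M + 1)), q j n • y j n) - h n (v n) ≤
      ((∑ j ∈ Finset.Icc 1 (aderN (M + 1)), q j n * h n (y j n)) - h n (y κ n)) +
        (h n (y κ n) - h n (v n)) := by
    intro n hn
    obtain ⟨hp, hs⟩ := hq n (Finset.mem_range.1 hn)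
    have := (hfconv n).map_sum_le (fun j hj => (hp j hj).le) hs (p := fun j => y j n)
      (fun _ _ => Set.mem_univ _)
    simp only [smul_eq_mul] at this
    linarith
  have := Finset.sum_le_sum hjensen
  rw [Finset.sum_add_distrib] at this
  linarith

end Ader

section MetaAlgorithm

lemma mem_gcLevels {t k : ℕ} : k ∈ gcLevels t ↔ 2 ^ k ≤ t := by
  unfold gcLevels
  rw [Finset.mem_filter, Finset.mem_range]
  refine ⟨fun h => h.2, fun h => ⟨?_, h⟩⟩
  have := Nat.lt_two_pow_self (n := k)
  omega

lemma add_div_two_pow {k i n : ℕ} (hn : n < 2 ^ k) : (i * 2 ^ k + n) / 2 ^ k = i := by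
  rw [mul_comm, Nat.mul_add_div (by positivity), Nat.div_eq_of_lt hn, add_zero]

lemma one_le_cAOA {s : ℕ} (hs : 1 ≤ s) : 1 ≤ cAOA s := by
  unfold cAOA
  have h1 : (1 : ℝ) ≤ s := by exact_mod_cast hs
  have h2 := Real.log_nonneg h1
  have h3 := Real.log_nonneg (show 1 ≤ 1 + Real.logb 2 s by
    linarith [Real.logb_nonneg (b := 2) (by norm_num) h1])
  have h4 := Real.log_nonneg (show 1 ≤ (5 + 3 * Real.log (1 + (s : ℝ))) / 2 by
    linarith [Real.log_nonneg (show 1 ≤ 1 + (s : ℝ) by linarith)])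
  linarith

/-- The number of geometric covering intervals starting by round `s`. -/
lemma card_covering_le (s : ℕ) :
    (((gcLevels s).sigma fun k => Finset.Icc 1 (s / 2 ^ k)).card : ℝ) ≤
      s * (1 + Real.logb 2 s) := by
  have h1 : ((gcLevels s).sigma fun k => Finset.Icc 1 (s / 2 ^ k)).card ≤ (Nat.log 2 s + 1) * s := by
    rw [Finset.card_sigma]
    have hsub : gcLevels s ⊆ Finset.range (Nat.log 2 s + 1) := fun k hk =>
      Finset.mem_range.2 (Nat.lt_succ_of_le
        (Nat.le_log_of_pow_le (by norm_num) (mem_gcLevels.1 hk)))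
    calc _ ≤ (gcLevels s).card * s := by
          rw [← smul_eq_mul]
          refine Finset.sum_le_card_nsmul _ _ _ fun k _ => ?_
          rw [Nat.card_Icc, Nat.add_sub_cancel]
          exact Nat.div_le_self _ _
      _ ≤ _ := by
          gcongr
          simpa using Finset.card_le_card hsub
  have h2 : ((Nat.log 2 s : ℕ) : ℝ) ≤ Real.logb 2 s := Real.natLog_le_logb s 2
  have h3 : (((gcLevels s).sigma fun k => Finset.Icc 1 (s / 2 ^ k)).card : ℝ) ≤
      ((Nat.log 2 s : ℕ) + 1) * s := by exact_mod_cast h1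
  nlinarith [(Nat.cast_nonneg s : (0 : ℝ) ≤ s)]

lemma filter_div_eq_Ico {k s i : ℕ} (hi : 1 ≤ i) :
    (Finset.Icc (2 ^ k) s).filter (fun t => t / 2 ^ k = i) =
      Finset.Ico (i * 2 ^ k) (min ((i + 1) * 2 ^ k) (s + 1)) := by
  ext t
  simp only [Finset.mem_filter, Finset.mem_Icc, Finset.mem_Ico, lt_min_iff]
  have hpos : 0 < 2 ^ k := by positivity
  rw [Nat.div_eq_iff hpos, mul_comm i]
  have : 2 ^ k ≤ 2 ^ k * i := Nat.le_mul_of_pos_right _ hi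
  have : (i + 1) * 2 ^ k = 2 ^ k * i + 2 ^ k := by ring
  omega

/-- Regrouping the active experts of rounds `1, …, s` by geometric covering interval. -/
lemma sum_active_eq_sum_covering (g : ℕ → ℕ → ℝ) (s : ℕ) :
    ∑ t ∈ Finset.Icc 1 s, ∑ k ∈ gcLevels t, g k t =
      ∑ p ∈ (gcLevels s).sigma fun k => Finset.Icc 1 (s / 2 ^ k),
        ∑ t ∈ Finset.Ico (p.2 * 2 ^ p.1) (min ((p.2 + 1) * 2 ^ p.1) (s + 1)), g p.1 t := by
  rw [Finset.sum_sigma, Finset.sum_comm' (s' := fun k => Finset.Icc (2 ^ k) s) (t' := gcLevels s)]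
  · refine Finset.sum_congr rfl fun k _ => ?_
    have hpos : 0 < 2 ^ k := by positivity
    rw [← Finset.sum_fiberwise_of_maps_to (g := fun t => t / 2 ^ k)
      (t := Finset.Icc 1 (s / 2 ^ k))]
    · exact Finset.sum_congr rfl fun i hi => by rw [filter_div_eq_Ico (Finset.mem_Icc.1 hi).1]
    · intro t ht
      obtain ⟨h1, h2⟩ := Finset.mem_Icc.1 ht
      exact Finset.mem_Icc.2 ⟨(Nat.one_le_div_iff hpos).2 h1, Nat.div_le_div_right h2⟩
  · intro t k
    simp only [Finset.mem_Icc, mem_gcLevels]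
    have : 0 < 2 ^ k := by positivity
    omega

variable {α : Type*} (f : ℕ → α → ℝ) (w : ℕ → α) (wI : ℕ → ℕ → ℕ → α)

lemma aoaMetaR_eq_sum_range {k i n : ℕ} (hi : 1 ≤ i) (hn : n < 2 ^ k) :
    aoaMetaR f w wI k (i * 2 ^ k + n) = ∑ l ∈ Finset.range n,
      (f (i * 2 ^ k + l) (w (i * 2 ^ k + l)) - f (i * 2 ^ k + l) (wI k i (i * 2 ^ k + l))) := by
  have hpos : 0 < i * 2 ^ k := by positivity
  unfold aoaMetaR
  rw [add_div_two_pow hn, Finset.Icc_sub_one_right_eq_Ico_of_not_isMin (by simp; omega),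
    Finset.sum_Ico_eq_sum_range, Nat.add_sub_cancel_left]

lemma aoaMetaC_eq_sum_range {k i n : ℕ} (hi : 1 ≤ i) (hn : n < 2 ^ k) :
    aoaMetaC f w wI k (i * 2 ^ k + n) = ∑ l ∈ Finset.range n,
      |f (i * 2 ^ k + l) (w (i * 2 ^ k + l)) - f (i * 2 ^ k + l) (wI k i (i * 2 ^ k + l))| := by
  have hpos : 0 < i * 2 ^ k := by positivity
  unfold aoaMetaC
  rw [add_div_two_pow hn, Finset.Icc_sub_one_right_eq_Ico_of_not_isMin (by simp; omega),
    Finset.sum_Ico_eq_sum_range, Nat.add_sub_cancel_left]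

lemma aoaMetaC_nonneg (k t : ℕ) : 0 ≤ aoaMetaC f w wI k t :=
  Finset.sum_nonneg fun _ _ => abs_nonneg _

/-- Regret of AOA with respect to the expert of a geometric covering interval. -/
lemma aoa_meta_regret {s : ℕ} (hs : 1 ≤ s)
    (hdiff : ∀ k i t, 1 ≤ i → i * 2 ^ k ≤ t → t < (i + 1) * 2 ^ k →
      |f t (w t) - f t (wI k i t)| ≤ 1)
    (hneg : ∀ t, 1 ≤ t → ∑ k ∈ gcLevels t, anhW (aoaMetaR f w wI k t) (aoaMetaC f w wI k t) *
      (f t (w t) - f t (wI k (t / 2 ^ k) t)) ≤ 0)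
    {k i : ℕ} (hi : 1 ≤ i) (hki : (i + 1) * 2 ^ k ≤ s + 1) :
    ∑ t ∈ Finset.Ico (i * 2 ^ k) ((i + 1) * 2 ^ k), (f t (w t) - f t (wI k i t)) ≤
      Real.sqrt (3 * 2 ^ k * cAOA s) := by
  set g : ℕ → ℕ → ℝ := fun k t => anhW (aoaMetaR f w wI k t) (aoaMetaC f w wI k t) *
      (f t (w t) - f t (wI k (t / 2 ^ k) t)) with hg
  set ρ : ℕ → ℕ → ℕ → ℝ := fun k i l =>
    f (i * 2 ^ k + l) (w (i * 2 ^ k + l)) - f (i * 2 ^ k + l) (wI k i (i * 2 ^ k + l)) with hρ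
  set L : ℝ := (5 + 3 * Real.log (1 + (s : ℝ))) / 2 with hL
  have hs1 : (1 : ℝ) ≤ s := by exact_mod_cast hs
  have hLpos : 0 < L := by
    have := Real.log_nonneg (show 1 ≤ 1 + (s : ℝ) by linarith)
    rw [hL]; linarith
  have hρ1 : ∀ k i l, 1 ≤ i → l < 2 ^ k → |ρ k i l| ≤ 1 := fun k i l hi hl =>
    hdiff k i _ hi (Nat.le_add_right _ _) (by rw [add_mul, one_mul]; omega)
  have hpot : ∀ k i n, 1 ≤ i → n ≤ 2 ^ k → n ≤ s →
      anhPot (∑ l ∈ Finset.range n, ρ k i l) (∑ l ∈ Finset.range n, |ρ k i l|) ≤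
        (∑ t ∈ Finset.Ico (i * 2 ^ k) (i * 2 ^ k + n), g k t) + L := by
    intro k i n hi hn hns
    have h1 := anhPot_le_sum (ρ k i) n (fun j hj => hρ1 k i j hi (by omega))
    have h2 : ∑ t ∈ Finset.Ico (i * 2 ^ k) (i * 2 ^ k + n), g k t = ∑ j ∈ Finset.range n,
        anhW (∑ l ∈ Finset.range j, ρ k i l) (∑ l ∈ Finset.range j, |ρ k i l|) * ρ k i j := by
      rw [Finset.sum_Ico_eq_sum_range, Nat.add_sub_cancel_left]
      refine Finset.sum_congr rfl fun j hj => ?_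
      have hj' : j < 2 ^ k := by have := Finset.mem_range.1 hj; omega
      simp only [hg, hρ]
      rw [aoaMetaR_eq_sum_range f w wI hi hj', aoaMetaC_eq_sum_range f w wI hi hj',
        add_div_two_pow hj']
    have h3 : Real.log (1 + (n : ℝ)) ≤ Real.log (1 + (s : ℝ)) := by
      have : (n : ℝ) ≤ s := by exact_mod_cast hns
      exact Real.log_le_log (by positivity) (by linarith)
    rw [h2, hL]
    linarith
  set T := (gcLevels s).sigma fun k => Finset.Icc 1 (s / 2 ^ k) with hT
  set B : (_ : ℕ) × ℕ → ℝ := fun p =>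
    ∑ t ∈ Finset.Ico (p.2 * 2 ^ p.1) (min ((p.2 + 1) * 2 ^ p.1) (s + 1)), g p.1 t with hB
  have htot : ∑ p ∈ T, B p ≤ 0 := by
    rw [hB, hT, ← sum_active_eq_sum_covering]
    exact Finset.sum_nonpos fun t ht => hneg t (Finset.mem_Icc.1 ht).1
  have hBL : ∀ p ∈ T, 0 ≤ B p + L := by
    rintro ⟨k, i⟩ hp
    obtain ⟨hk, hi⟩ := Finset.mem_sigma.1 hp
    obtain ⟨hi1, hi2⟩ := Finset.mem_Icc.1 hi
    have hpos : 0 < 2 ^ k := by positivity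
    have hle : i * 2 ^ k ≤ s := (Nat.le_div_iff_mul_le hpos).1 hi2
    have hge : 2 ^ k ≤ i * 2 ^ k := Nat.le_mul_of_pos_left _ hi1
    obtain ⟨n, hn⟩ : ∃ n, min ((i + 1) * 2 ^ k) (s + 1) = i * 2 ^ k + n :=
      ⟨min ((i + 1) * 2 ^ k) (s + 1) - i * 2 ^ k, by rw [add_mul, one_mul]; omega⟩
    rw [add_mul, one_mul] at hn
    have h1 := hpot k i n hi1 (by omega) (by omega)
    have h2 := one_le_anhPot (∑ l ∈ Finset.range n, ρ k i l)
      (Finset.sum_nonneg fun l (_ : l ∈ Finset.range n) => abs_nonneg (ρ k i l))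
    simp only [hB]
    rw [add_mul, one_mul, hn]
    linarith
  have hpos : 0 < 2 ^ k := by positivity
  have hge : 2 ^ k ≤ i * 2 ^ k := Nat.le_mul_of_pos_left _ hi
  rw [add_mul, one_mul] at hki
  have hmem : (⟨k, i⟩ : (_ : ℕ) × ℕ) ∈ T := by
    rw [hT, Finset.mem_sigma, mem_gcLevels, Finset.mem_Icc]
    exact ⟨show 2 ^ k ≤ s by omega, hi,
      (Nat.le_div_iff_mul_le hpos).2 (show i * 2 ^ k ≤ s by omega)⟩
  have hsingle := Finset.single_le_sum hBL hmem
  rw [Finset.sum_add_distrib, Finset.sum_const, nsmul_eq_mul] at hsingle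
  have hBki : B ⟨k, i⟩ = ∑ t ∈ Finset.Ico (i * 2 ^ k) (i * 2 ^ k + 2 ^ k), g k t := by
    simp only [hB]
    rw [add_mul, one_mul, min_eq_left hki]
  have hΦ := hpot k i (2 ^ k) hi le_rfl (by omega)
  rw [← hBki] at hΦ
  have hlogb : 0 ≤ Real.logb 2 s := Real.logb_nonneg (by norm_num) hs1
  have hM : anhPot (∑ l ∈ Finset.range (2 ^ k), ρ k i l) (∑ l ∈ Finset.range (2 ^ k), |ρ k i l|) ≤
      s * (1 + Real.logb 2 s) * L := by
    have := mul_le_mul_of_nonneg_right (card_covering_le s) hLpos.le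
    linarith
  have hlogM : Real.log (s * (1 + Real.logb 2 s) * L) ≤ cAOA s := by
    rw [Real.log_mul (by positivity) hLpos.ne', Real.log_mul (by positivity) (by positivity)]
    unfold cAOA
    linarith
  have hC : ∑ l ∈ Finset.range (2 ^ k), |ρ k i l| ≤ (2 : ℝ) ^ k := by
    have := Finset.sum_le_card_nsmul (Finset.range (2 ^ k)) (fun l => |ρ k i l|) 1
      (fun l hl => hρ1 k i l hi (Finset.mem_range.1 hl))
    simpa using this
  have := le_sqrt_of_anhPot_le hC (Finset.abs_sum_le_sum_abs _ _) (by positivity) hM hlogM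
    (zero_le_one.trans (one_le_cAOA hs))
  rwa [add_mul, one_mul, Finset.sum_Ico_eq_sum_range, Nat.add_sub_cancel_left]

end MetaAlgorithm

/-- Theorem 6, main guarantee of AOA: under the AOA algorithm,
for every interval `I = [r,s]` of positive integers and every comparator sequence
`u` in `Ω` on `I` with local path-length `P_I`,
`Σ_{t=r}^{s} (f_t(w_t) − f_t(u_t)) ≤ (14√(c'(s)) + 3(1 + 2ln(k_I + 1)) + 23DG)·√|I|
  + 5G√(DP_I)·√|I|` with `k_I = ⌊(1/2)log₂(1 + 4P_I/(7D))⌋ + 1`. -/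
theorem aoa_any_interval_dynamic_regret
    (d : ℕ) (D G : ℝ)
    (Ω : Set (EuclideanSpace ℝ (Fin d)))
    (hne : Ω.Nonempty) (hcomp : IsCompact Ω) (hconv : Convex ℝ Ω)
    (hdiam : ∀ z ∈ Ω, ∀ z' ∈ Ω, ‖z - z'‖ ≤ D)
    (f : ℕ → EuclideanSpace ℝ (Fin d) → ℝ)
    (hfconv : ∀ t, ConvexOn ℝ Set.univ (f t))
    (hfdiff : ∀ t z, DifferentiableAt ℝ (f t) z)
    (hgrad : ∀ t, ∀ z ∈ Ω, ‖gradient (f t) z‖ ≤ G)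
    (hrange : ∀ t, ∀ z ∈ Ω, 0 ≤ f t z ∧ f t z ≤ 1)
    (proj : EuclideanSpace ℝ (Fin d) → EuclideanSpace ℝ (Fin d))
    (hproj : ∀ z, proj z ∈ Ω ∧ ∀ z' ∈ Ω, ‖proj z - z‖ ≤ ‖z' - z‖)
    (y : ℕ → ℕ → ℕ → ℕ → EuclideanSpace ℝ (Fin d))
    (q : ℕ → ℕ → ℕ → ℕ → ℝ)
    (wI : ℕ → ℕ → ℕ → EuclideanSpace ℝ (Fin d))
    (w : ℕ → EuclideanSpace ℝ (Fin d))
    (hy0 : ∀ k i j, y k i j (i * 2 ^ k) ∈ Ω)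
    (hyup : ∀ k i j t, i * 2 ^ k ≤ t → t + 1 ≤ (i + 1) * 2 ^ k - 1 →
      y k i j (t + 1) = proj (y k i j t - aderEta D G (2 ^ k) j • gradient (f t) (y k i j t)))
    (hq0 : ∀ k i j, 1 ≤ j → j ≤ aderN (2 ^ k) →
      q k i j (i * 2 ^ k) = (1 + 1 / (aderN (2 ^ k) : ℝ)) / ((j : ℝ) * ((j : ℝ) + 1)))
    (hqup : ∀ k i j t, i * 2 ^ k ≤ t → t + 1 ≤ (i + 1) * 2 ^ k - 1 →
      q k i j (t + 1) = q k i j t * Real.exp (-(aderAlpha (2 ^ k)) * f t (y k i j t)) /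
        ∑ j' ∈ Finset.Icc 1 (aderN (2 ^ k)),
          q k i j' t * Real.exp (-(aderAlpha (2 ^ k)) * f t (y k i j' t)))
    (hwI : ∀ k i t, wI k i t = ∑ j ∈ Finset.Icc 1 (aderN (2 ^ k)), q k i j t • y k i j t)
    (hw : ∀ t, 1 ≤ t → w t = ∑ k ∈ gcLevels t, aoaWeight f w wI k t • wI k (t / 2 ^ k) t)
    (r s : ℕ) (hr : 1 ≤ r) (hrs : r ≤ s)
    (u : ℕ → EuclideanSpace ℝ (Fin d))
    (hu : ∀ t, r ≤ t → t ≤ s → u t ∈ Ω)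
    (P : ℝ) (hP : P = ∑ t ∈ Finset.Ico r s, ‖u (t + 1) - u t‖) :
    ∑ t ∈ Finset.Icc r s, (f t (w t) - f t (u t))
      ≤ (14 * Real.sqrt (cAOA s)
          + 3 * (1 + 2 * Real.log (((⌊Real.logb 2 (1 + 4 * P / (7 * D)) / 2⌋₊ + 1 : ℕ) : ℝ) + 1))
          + 23 * D * G) * Real.sqrt ((s - r + 1 : ℕ) : ℝ)
        + 5 * G * Real.sqrt (D * P) * Real.sqrt ((s - r + 1 : ℕ) : ℝ) := by
  have hD0 : 0 ≤ D := by
    obtain ⟨z, hz⟩ := hne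
    exact (norm_nonneg _).trans (hdiam z hz z hz)
  have hG0 : 0 ≤ G := by
    obtain ⟨z, hz⟩ := hne
    exact (norm_nonneg _).trans (hgrad 0 z hz)
  have hP0 : 0 ≤ P := by rw [hP]; exact Finset.sum_nonneg fun _ _ => norm_nonneg _
  have hs : 1 ≤ s := hr.trans hrs
  have hshift : ∀ {k i n : ℕ}, n + 1 < 2 ^ k → i * 2 ^ k + n + 1 ≤ (i + 1) * 2 ^ k - 1 := by
    intro k i n hn
    rw [add_mul, one_mul]; omega
  have hinv := fun k i : ℕ => ader_invariants (D := D) (G := G) (fun z => (hproj z).1) (2 ^ k)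
    (fun n => f (i * 2 ^ k + n)) (fun n => hrange _) (fun n => gradient (f (i * 2 ^ k + n)))
    (fun j n => y k i j (i * 2 ^ k + n)) (fun j n => q k i j (i * 2 ^ k + n))
    (fun j => hy0 k i j) (fun j n hn => hyup k i j _ (Nat.le_add_right _ _) (hshift hn))
    (fun j => hq0 k i j) (fun j n hn => hqup k i j _ (Nat.le_add_right _ _) (hshift hn))
  have hwImem : ∀ k i t, i * 2 ^ k ≤ t → t < (i + 1) * 2 ^ k → wI k i t ∈ Ω := by
    intro k i t h1 h2
    obtain ⟨n, rfl⟩ := Nat.exists_eq_add_of_le h1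
    rw [add_mul, one_mul] at h2
    have hn : n < 2 ^ k := by omega
    obtain ⟨hy, hq, -⟩ := hinv k i
    obtain ⟨hpos, hsum⟩ := hq n hn
    rw [hwI]
    exact hconv.sum_mem (fun j hj => (hpos j hj).le) hsum (fun j _ => hy j n hn)
  have hactive : ∀ t k, k ∈ gcLevels t → wI k (t / 2 ^ k) t ∈ Ω := fun t k _ =>
    hwImem k _ t (Nat.div_mul_le_self _ _) (by
      rw [mul_comm]; exact Nat.lt_mul_div_succ t (by positivity))
  have hWnonneg : ∀ t k, 0 ≤ anhW (aoaMetaR f w wI k t) (aoaMetaC f w wI k t) := fun t k =>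
    anhW_nonneg _ (aoaMetaC_nonneg f w wI k t)
  have hWpos : ∀ t, 1 ≤ t →
      0 < ∑ k ∈ gcLevels t, anhW (aoaMetaR f w wI k t) (aoaMetaC f w wI k t) := by
    intro t ht
    refine Finset.sum_pos' (fun k _ => hWnonneg t k) ⟨0, mem_gcLevels.2 (by simpa), ?_⟩
    have e : t = t * 2 ^ 0 + 0 := by simp
    rw [e, aoaMetaR_eq_sum_range f w wI ht (by simp), aoaMetaC_eq_sum_range f w wI ht (by simp)]
    simpa using anhW_zero_pos
  have hp_nonneg : ∀ t k, 0 ≤ aoaWeight f w wI k t := fun t k =>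
    div_nonneg (hWnonneg t k) (Finset.sum_nonneg fun k _ => hWnonneg t k)
  have hp_sum : ∀ t, 1 ≤ t → ∑ k ∈ gcLevels t, aoaWeight f w wI k t = 1 := by
    intro t ht
    unfold aoaWeight
    rw [← Finset.sum_div]
    exact div_self (hWpos t ht).ne'
  have hwmem : ∀ t, 1 ≤ t → w t ∈ Ω := by
    intro t ht
    rw [hw t ht]
    exact hconv.sum_mem (fun k _ => hp_nonneg t k) (hp_sum t ht) (hactive t)
  have hneg : ∀ t, 1 ≤ t →
      ∑ k ∈ gcLevels t, anhW (aoaMetaR f w wI k t) (aoaMetaC f w wI k t) *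
        (f t (w t) - f t (wI k (t / 2 ^ k) t)) ≤ 0 := by
    intro t ht
    have hj := (hfconv t).map_sum_le (t := gcLevels t) (w := fun k => aoaWeight f w wI k t)
      (p := fun k => wI k (t / 2 ^ k) t) (fun k _ => hp_nonneg t k) (hp_sum t ht)
      (fun _ _ => Set.mem_univ _)
    rw [← hw t ht] at hj
    simp only [smul_eq_mul, aoaWeight, div_mul_eq_mul_div] at hj
    rw [← Finset.sum_div, le_div_iff₀ (hWpos t ht)] at hj
    simp only [mul_sub]
    rw [Finset.sum_sub_distrib, ← Finset.sum_mul]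
    linarith
  have hdiff : ∀ k i t, 1 ≤ i → i * 2 ^ k ≤ t → t < (i + 1) * 2 ^ k →
      |f t (w t) - f t (wI k i t)| ≤ 1 := by
    intro k i t hi h1 h2
    have ht : 1 ≤ t := (Nat.mul_pos hi (by positivity)).trans_le h1
    have a := hrange t _ (hwmem t ht)
    have b := hrange t _ (hwImem k i t h1 h2)
    rw [abs_le]
    constructor <;> linarith [a.1, a.2, b.1, b.2]
  have hc1 := one_le_cAOA hs
  have hsc1 : 1 ≤ Real.sqrt (cAOA s) := Real.one_le_sqrt.2 hc1
  set κ := ⌊Real.logb 2 (1 + 4 * P / (7 * D)) / 2⌋₊ + 1 with hκ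
  have hlogκ : 0 ≤ Real.log ((κ : ℝ) + 1) := Real.log_nonneg (by
    linarith [(Nat.cast_nonneg κ : (0 : ℝ) ≤ κ)])
  rcases (mul_nonneg hG0 hD0).eq_or_lt with hGD | hGD
  · have hterm : ∀ t ∈ Finset.Icc r s, f t (w t) - f t (u t) ≤ 0 := by
      intro t ht
      obtain ⟨h1, h2⟩ := Finset.mem_Icc.1 ht
      have hwt := hwmem t (hr.trans h1)
      refine ((hfconv t).sub_le_inner_gradient (hfdiff t _) (u t)).trans ?_
      rw [hGD]
      exact (real_inner_le_norm _ _).trans (mul_le_mul (hgrad t _ hwt)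
        (hdiam _ hwt _ (hu t h1 h2)) (norm_nonneg _) hG0)
    refine (Finset.sum_nonpos hterm).trans ?_
    positivity
  have hD : 0 < D := pos_of_mul_pos_right hGD hG0
  have hG : 0 < G := pos_of_mul_pos_left hGD hD0
  set c : ℝ := Real.sqrt 3 * Real.sqrt (cAOA s) +
    (3 / 2 + Real.log ((κ : ℝ) + 1) + 3 * D * G) with hc
  have hc0 : 0 ≤ c := by positivity
  set F : ℕ → ℕ → ℝ := fun a b => ∑ t ∈ Finset.Ico a b, (f t (w t) - f t (u t)) with hF
  set Q : ℕ → ℕ → ℝ := fun a b => ∑ t ∈ Finset.Ico a (b - 1), ‖u (t + 1) - u t‖ with hQ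
  have hQmono : ∀ a b, r ≤ a → b ≤ s + 1 → Q a b ≤ P := by
    intro a b ha hb
    rw [hP]
    exact Finset.sum_le_sum_of_subset_of_nonneg (Finset.Ico_subset_Ico ha (by omega))
      fun _ _ _ => norm_nonneg _
  have hmain := le_of_le_on_covering_intervals (F := F) (P := Q) (c := c)
    (e := 3 * G * Real.sqrt D) hr (hrs.trans (Nat.le_succ s)) hc0 (by positivity)
    (fun a b d hab hbd => (Finset.sum_Ico_consecutive _ hab hbd).symm)
    (fun a b => Finset.sum_nonneg fun _ _ => norm_nonneg _)
    (fun a b d hab hbd => by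
      simp only [hQ]
      rw [← Finset.sum_union (Finset.disjoint_left.2 fun t h1 h2 => by
        rw [Finset.mem_Ico] at h1 h2; omega)]
      refine Finset.sum_le_sum_of_subset_of_nonneg (fun t ht => ?_) fun _ _ _ => norm_nonneg _
      rw [Finset.mem_union, Finset.mem_Ico, Finset.mem_Ico] at ht
      rw [Finset.mem_Ico]; omega)
    (fun k i hi h1 h2 => by
      obtain ⟨M, hM⟩ : ∃ M, 2 ^ k = M + 1 := Nat.exists_eq_succ_of_ne_zero (by positivity)
      have hmeta := aoa_meta_regret f w wI hs hdiff hneg hi h2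
      have hader := ader_dynamic_regret hD hG hconv hdiam hproj M
        (fun n => f (i * 2 ^ k + n)) (fun n => hfconv _) (fun n => hfdiff _) (fun n => hgrad _)
        (fun n => hrange _) (fun j n => y k i j (i * 2 ^ k + n))
        (fun j n => q k i j (i * 2 ^ k + n)) (fun j => hy0 k i j)
        (by
          rw [← hM]
          exact fun j n hn => hyup k i j _ (Nat.le_add_right _ _) (hshift hn))
        (by rw [← hM]; exact fun j => hq0 k i j)
        (by
          rw [← hM]
          exact fun j n hn => hqup k i j _ (Nat.le_add_right _ _) (hshift hn))
        (fun n => u (i * 2 ^ k + n))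
        (fun n hn => hu _ (by omega) (by rw [add_mul, one_mul] at h2; omega))
        (P := Q (i * 2 ^ k) ((i + 1) * 2 ^ k)) (by
          simp only [hQ]
          rw [Finset.sum_Ico_eq_sum_range]
          have : (i + 1) * 2 ^ k - 1 - i * 2 ^ k = M := by rw [add_mul, one_mul]; omega
          rw [this]
          rfl)
      have hQ0 : 0 ≤ Q (i * 2 ^ k) ((i + 1) * 2 ^ k) :=
        Finset.sum_nonneg fun _ _ => norm_nonneg _
      have hlog : Real.log (((⌊Real.logb 2 (1 + 4 * Q (i * 2 ^ k) ((i + 1) * 2 ^ k) /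
          (7 * D)) / 2⌋₊ + 1 : ℕ) : ℝ) + 1) ≤ Real.log ((κ : ℝ) + 1) := by
        have h3 : 4 * Q (i * 2 ^ k) ((i + 1) * 2 ^ k) / (7 * D) ≤ 4 * P / (7 * D) := by
          have := hQmono _ _ h1 h2
          gcongr
        have h4 : 0 ≤ 4 * Q (i * 2 ^ k) ((i + 1) * 2 ^ k) / (7 * D) := by positivity
        have h5 := Real.logb_le_logb_of_le (b := 2) (by norm_num) (by linarith)
          (add_le_add_right h3 1)
        have h6 : ⌊Real.logb 2 (1 + 4 * Q (i * 2 ^ k) ((i + 1) * 2 ^ k) / (7 * D)) / 2⌋₊ + 1 ≤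
            κ := by
          rw [hκ]
          exact Nat.add_le_add_right (Nat.floor_mono (by linarith)) 1
        have h7 : ((⌊Real.logb 2 (1 + 4 * Q (i * 2 ^ k) ((i + 1) * 2 ^ k) / (7 * D)) / 2⌋₊ + 1 :
          ℕ) : ℝ) ≤ κ := by exact_mod_cast h6
        exact Real.log_le_log (by positivity) (by linarith)
      have hMr : (M : ℝ) + 1 = 2 ^ k := by exact_mod_cast hM.symm
      have hsum : F (i * 2 ^ k) ((i + 1) * 2 ^ k) =
          (∑ t ∈ Finset.Ico (i * 2 ^ k) ((i + 1) * 2 ^ k), (f t (w t) - f t (wI k i t))) +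
          ∑ n ∈ Finset.range (M + 1),
            (f (i * 2 ^ k + n) (∑ j ∈ Finset.Icc 1 (aderN (M + 1)),
              q k i j (i * 2 ^ k + n) • y k i j (i * 2 ^ k + n)) -
              f (i * 2 ^ k + n) (u (i * 2 ^ k + n))) := by
        simp only [hF]
        rw [add_mul, one_mul, Finset.sum_Ico_eq_sum_range, Finset.sum_Ico_eq_sum_range,
          Nat.add_sub_cancel_left, ← hM, ← Finset.sum_add_distrib]
        refine Finset.sum_congr rfl fun n _ => ?_
        rw [hwI]; ring
      have hsq : Real.sqrt (3 * 2 ^ k * cAOA s) =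
          Real.sqrt 3 * Real.sqrt (cAOA s) * Real.sqrt (2 ^ k) := by
        rw [Real.sqrt_mul (by positivity), Real.sqrt_mul (by norm_num)]; ring
      rw [hMr] at hader
      rw [hsq] at hmeta
      rw [hsum, Real.sqrt_mul (by positivity : (0 : ℝ) ≤ 2 ^ k), hc]
      have := mul_le_mul_of_nonneg_right hlog (Real.sqrt_nonneg ((2 : ℝ) ^ k))
      linarith)
  have hlen : ((s + 1 : ℕ) : ℝ) - r = ((s - r + 1 : ℕ) : ℝ) := by
    push_cast [Nat.cast_sub hrs]; ring
  rw [hlen] at hmain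
  have hFrs : F r (s + 1) = ∑ t ∈ Finset.Icc r s, (f t (w t) - f t (u t)) := by
    simp only [hF]
    rw [Finset.Ico_add_one_right_eq_Icc]
  rw [hFrs] at hmain
  refine hmain.trans ?_
  have hQP : Q r (s + 1) = P := by rw [hP]; simp only [hQ, Nat.add_sub_cancel]
  rw [hQP, Real.sqrt_mul (Nat.cast_nonneg _), Real.sqrt_mul hD.le]
  set n := Real.sqrt ((s - r + 1 : ℕ) : ℝ)
  have hn : 0 ≤ n := Real.sqrt_nonneg _
  have h3 : Real.sqrt 3 ≤ 9 / 5 := by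
    rw [Real.sqrt_le_left (by norm_num)]; norm_num
  have hcoef : 5 * c ≤ 14 * Real.sqrt (cAOA s) + 3 * (1 + 2 * Real.log ((κ : ℝ) + 1)) +
      23 * D * G := by
    have := mul_le_mul_of_nonneg_right h3 (Real.sqrt_nonneg (cAOA s))
    have : 0 ≤ D * G := by positivity
    rw [hc]
    linarith
  have h5 := mul_le_mul_of_nonneg_right hcoef hn
  have h6 : 0 ≤ G * (Real.sqrt D * Real.sqrt P) * n := by positivity
  linarith
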